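/- Let n ≥ 2, 0 < α < 1, and let g(x) = ((1+‖x‖^α)/‖x‖)·x on ℝⁿ ∖ {0}. Then for every x with 0 < ‖x‖ < 1, the minimal stretching of the derivative of g at x equals l(g′(x)) := inf{‖g′(x)h‖ : ‖h‖ = 1} = α·‖x‖^{α−1}, and consequently the inner dilatation K_I(x,g) = |det g′(x)| / l(g′(x))^n equals ((1+‖x‖^α)/(α·‖x‖^α))^{n−1}. -/

import Mathlib

/-- The Fréchet derivative of a radial map `x ↦ φ(‖x‖) x` away from the origin. -/
theorem HasDerivAt.hasFDerivAt_norm_smul {E : Type*} [NormedAddCommGroup E]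
    [InnerProductSpace ℝ E] {φ : ℝ → ℝ} {φ' : ℝ} {x : E} (hx : x ≠ 0)
    (hφ : HasDerivAt φ φ' ‖x‖) :
    HasFDerivAt (fun y : E => φ ‖y‖ • y)
      (φ ‖x‖ • ContinuousLinearMap.id ℝ E +
        ((φ' / ‖x‖) • innerSL ℝ x).smulRight x) x := by
  have hnorm : HasFDerivAt (fun y : E => ‖y‖) ((1 / ‖x‖) • innerSL ℝ x) x := by
    have h := (hasStrictFDerivAt_norm_sq x).hasFDerivAt.sqrt (by positivity)
    simp only [Real.sqrt_sq (norm_nonneg _)] at h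
    convert h using 1
    ext y
    simp
    field_simp
  refine ((hφ.comp_hasFDerivAt x hnorm).smul (hasFDerivAt_id x)).congr_fderiv ?_
  ext1 y
  simp [div_eq_mul_inv, mul_assoc]

/-- The determinant of a nonzero multiple of the identity plus a rank one map. -/
theorem LinearMap.det_smul_id_add_smulRight {K V : Type*} [Field K] [AddCommGroup V]
    [Module K V] [FiniteDimensional K V] {a : K} (ha : a ≠ 0) (f : V →ₗ[K] K) (v : V) :
    LinearMap.det (a • LinearMap.id + f.smulRight v) =
      a ^ Module.finrank K V * (1 + a⁻¹ * f v) := by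
  have h : a • LinearMap.id + f.smulRight v = a • LinearMap.transvection (a⁻¹ • f) v := by
    ext y
    simp [LinearMap.transvection.apply, smul_smul, ha]
  rw [h, LinearMap.det_smul, LinearMap.transvection.det]
  simp

/-- The squared norm of the image of a vector under the map that scales by `b` along `x` and
by `a` orthogonally to `x`. -/
theorem norm_sq_smul_add_inner_smul {E : Type*} [NormedAddCommGroup E]
    [InnerProductSpace ℝ E] {x : E} (hx : x ≠ 0) (a b : ℝ) (h : E) :
    ‖a • h + ((b - a) / ‖x‖ ^ 2 * inner ℝ x h) • x‖ ^ 2 =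
      a ^ 2 * ‖h‖ ^ 2 + (b ^ 2 - a ^ 2) * (inner ℝ x h / ‖x‖) ^ 2 := by
  have hx' : ‖x‖ ≠ 0 := norm_ne_zero_iff.mpr hx
  rw [norm_add_sq_real, norm_smul, norm_smul, real_inner_smul_left, real_inner_smul_right,
    real_inner_comm, mul_pow, mul_pow, Real.norm_eq_abs, Real.norm_eq_abs, sq_abs, sq_abs]
  field_simp
  ring

/-- The map that scales by `b` along `x` and by `a ≥ b` orthogonally to `x` has minimal
stretching `b`. -/
theorem sInf_norm_smul_add_inner_smul {E : Type*} [NormedAddCommGroup E]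
    [InnerProductSpace ℝ E] {x : E} (hx : x ≠ 0) {a b : ℝ} (hb : 0 ≤ b) (hab : b ≤ a) :
    sInf {r : ℝ | ∃ h : E, ‖h‖ = 1 ∧
      r = ‖a • h + ((b - a) / ‖x‖ ^ 2 * inner ℝ x h) • x‖} = b := by
  have hx' : ‖x‖ ≠ 0 := norm_ne_zero_iff.mpr hx
  refine IsLeast.csInf_eq ⟨⟨‖x‖⁻¹ • x, ?_, ?_⟩, ?_⟩
  · simp [norm_smul, hx']
  · rw [← sq_eq_sq₀ hb (norm_nonneg _), norm_sq_smul_add_inner_smul hx, norm_smul,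
      real_inner_smul_right, real_inner_self_eq_norm_sq, norm_inv, norm_norm]
    field_simp
    ring
  · rintro _ ⟨h, hh, rfl⟩
    rw [← sq_le_sq₀ hb (norm_nonneg _), norm_sq_smul_add_inner_smul hx, hh]
    have hcs : (inner ℝ x h / ‖x‖) ^ 2 ≤ 1 := by
      rw [sq_le_one_iff_abs_le_one, abs_div, abs_norm]
      refine div_le_one_of_le₀ ?_ (norm_nonneg _)
      simpa [hh] using abs_real_inner_le_norm x h
    nlinarith [mul_nonneg (sub_nonneg.mpr (pow_le_pow_left₀ hb hab 2)) (sub_nonneg.mpr hcs)]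


/-- For `n ≥ 2`, `0 < α < 1` and `g(x) = ((1+‖x‖^α)/‖x‖)·x`, at every `x` with
`0 < ‖x‖ < 1` the minimal stretching `l(g′(x)) = inf{‖g′(x)h‖ : ‖h‖ = 1}`
equals `α·‖x‖^(α−1)`, and the inner dilatation
`K_I(x,g) = |det g′(x)| / l(g′(x))^n` equals `((1+‖x‖^α)/(α·‖x‖^α))^(n−1)`. -/
theorem g_minimal_stretching_and_inner_dilatation
    (n : ℕ) (hn : 2 ≤ n) (α : ℝ) (hα₀ : 0 < α) (hα₁ : α < 1)
    (g : EuclideanSpace ℝ (Fin n) → EuclideanSpace ℝ (Fin n))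
    (hg : ∀ x : EuclideanSpace ℝ (Fin n), x ≠ 0 →
      g x = ((1 + ‖x‖ ^ α) / ‖x‖) • x)
    (x : EuclideanSpace ℝ (Fin n)) (hx₀ : 0 < ‖x‖) (hx₁ : ‖x‖ < 1) :
    sInf {r : ℝ | ∃ h : EuclideanSpace ℝ (Fin n), ‖h‖ = 1 ∧ r = ‖fderiv ℝ g x h‖} =
      α * ‖x‖ ^ (α - 1) ∧
    |LinearMap.det (fderiv ℝ g x :
        EuclideanSpace ℝ (Fin n) →ₗ[ℝ] EuclideanSpace ℝ (Fin n))| /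
      (sInf {r : ℝ | ∃ h : EuclideanSpace ℝ (Fin n), ‖h‖ = 1 ∧ r = ‖fderiv ℝ g x h‖}) ^ n =
      ((1 + ‖x‖ ^ α) / (α * ‖x‖ ^ α)) ^ (n - 1) := by
  have hx : x ≠ 0 := norm_pos_iff.mp hx₀
  have hxn : ‖x‖ ≠ 0 := hx₀.ne'
  have hpow : 0 < ‖x‖ ^ α := Real.rpow_pos_of_pos hx₀ α
  have hrpow : ‖x‖ ^ (α - 1) = ‖x‖ ^ α / ‖x‖ := Real.rpow_sub_one hxn α
  set a : ℝ := (1 + ‖x‖ ^ α) / ‖x‖ with ha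
  set b : ℝ := α * ‖x‖ ^ (α - 1) with hb
  have ha₀ : 0 < a := by positivity
  have hb₀ : 0 < b := by positivity
  have hab : b ≤ a := by
    rw [ha, hb, hrpow, ← mul_div_assoc]
    gcongr
    nlinarith
  have hφ : HasDerivAt (fun r : ℝ => (1 + r ^ α) / r) ((b - a) / ‖x‖) ‖x‖ := by
    refine (((Real.hasDerivAt_rpow_const (p := α) (Or.inl hxn)).const_add 1).div
      (hasDerivAt_id ‖x‖) hxn).congr_deriv ?_
    simp only [ha, hb, id]
    field_simp
  have hderiv : fderiv ℝ g x = a • ContinuousLinearMap.id ℝ (EuclideanSpace ℝ (Fin n)) +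
      (((b - a) / ‖x‖ / ‖x‖) • innerSL ℝ x).smulRight x := by
    refine ((hφ.hasFDerivAt_norm_smul hx).congr_of_eventuallyEq ?_).fderiv
    filter_upwards [isOpen_ne.mem_nhds hx] with y hy using hg y hy
  have happly (h : EuclideanSpace ℝ (Fin n)) :
      fderiv ℝ g x h = a • h + ((b - a) / ‖x‖ ^ 2 * inner ℝ x h) • x := by
    rw [hderiv]
    simp [div_div, sq]
  have hinf : sInf {r : ℝ | ∃ h : EuclideanSpace ℝ (Fin n),
      ‖h‖ = 1 ∧ r = ‖fderiv ℝ g x h‖} = b := by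
    simp only [happly]
    exact sInf_norm_smul_add_inner_smul hx hb₀.le hab
  have hdet : LinearMap.det (fderiv ℝ g x :
      EuclideanSpace ℝ (Fin n) →ₗ[ℝ] EuclideanSpace ℝ (Fin n)) = a ^ (n - 1) * b := by
    have hcoe : (fderiv ℝ g x : EuclideanSpace ℝ (Fin n) →ₗ[ℝ] EuclideanSpace ℝ (Fin n)) =
        a • LinearMap.id + (((b - a) / ‖x‖ ^ 2) • innerₗ _ x).smulRight x := by
      ext1 h
      simp [happly]
    rw [hcoe, LinearMap.det_smul_id_add_smulRight ha₀.ne', finrank_euclideanSpace_fin,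
      ← pow_sub_one_mul (by lia : n ≠ 0) a,
      LinearMap.smul_apply, innerₗ_apply_apply, real_inner_self_eq_norm_sq, smul_eq_mul,
      div_mul_cancel₀ _ (pow_ne_zero 2 hxn)]
    field_simp
    ring
  refine ⟨hinf, ?_⟩
  have hratio : (1 + ‖x‖ ^ α) / (α * ‖x‖ ^ α) = a / b := by
    rw [ha, hb, hrpow]
    field_simp
  rw [hinf, hdet, abs_of_pos (by positivity), hratio, div_pow a b,
    ← pow_sub_one_mul (by lia : n ≠ 0) b, mul_div_mul_right _ _ hb₀.ne']
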